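/- Assume init j ≥ 0 for every j and every amount occurring in every list T p is nonnegative. Let S and S' be valid processing sequences. Then there exists a valid processing sequence S'' having S' as a prefix such that every event occurring in S occurs in S''. (Any valid processing order can be extended to process everything that any other valid processing order has processed.) -/

import Mathlib

/-- A money transfer: sender `s`, receiver `r`, amount `v`. -/
structure Transfer (n : ℕ) where
  s : Fin n
  r : Fin n
  v : ℤ

/-- Total money transferred to `j` in `L`. -/
def plus {n : ℕ} (j : Fin n) (L : List (Transfer n)) : ℤ :=
  ((L.filter (fun t => decide (t.r = j))).map (fun t => t.v)).sum

/-- Total money transferred from `j` in `L`. -/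
def minus {n : ℕ} (j : Fin n) (L : List (Transfer n)) : ℤ :=
  ((L.filter (fun t => decide (t.s = j))).map (fun t => t.v)).sum

/-- The value of `j`'s account after the transfers of `L`. -/
def acc {n : ℕ} (init : Fin n → ℤ) (j : Fin n) (L : List (Transfer n)) : ℤ :=
  init j + plus j L - minus j L

/-- The transfer induced by the event `(p, m)`: sender `p`, receiver and
amount given by the `m`-th transfer issued by `p` (i.e. the `m`-th entry
of `T p`). -/
def inducedTransfer {n : ℕ} (T : Fin n → List (Fin n × ℤ)) (e : Fin n × ℕ) :
    Transfer n :=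
  { s := e.1
    r := ((T e.1).getD e.2 (e.1, 0)).1
    v := ((T e.1).getD e.2 (e.1, 0)).2 }

/-- The induced transfer list of a processing sequence. -/
def inducedList {n : ℕ} (T : Fin n → List (Fin n × ℤ))
    (S : List (Fin n × ℕ)) : List (Transfer n) :=
  S.map (inducedTransfer T)

/-- `S` is a processing sequence: a duplicate-free list of events,
where an event is a pair `(p, m)` with `m < (T p).length`. -/
def IsProcSeq {n : ℕ} (T : Fin n → List (Fin n × ℤ))
    (S : List (Fin n × ℕ)) : Prop :=
  S.Nodup ∧ ∀ e ∈ S, e.2 < (T e.1).length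

/-- FIFO condition: whenever the event `(p, m)` occurs at some position of
`S`, every event `(p, m')` with `m' < m` occurs at an earlier position. -/
def FIFO {n : ℕ} (S : List (Fin n × ℕ)) : Prop :=
  ∀ (z : ℕ) (hz : z < S.length) (m' : ℕ), m' < (S[z]'hz).2 →
    ∃ (z' : ℕ) (hz' : z' < S.length), z' < z ∧ (S[z']'hz') = ((S[z]'hz).1, m')

/-- Balance condition: whenever an event occurs at position `z` of `S`, the
amount of its induced transfer is at most the sender's account computed from
the induced transfer list of the first `z` entries of `S`. -/
def Balance {n : ℕ} (init : Fin n → ℤ) (T : Fin n → List (Fin n × ℤ))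
    (S : List (Fin n × ℕ)) : Prop :=
  ∀ (z : ℕ) (hz : z < S.length),
    (inducedTransfer T (S[z]'hz)).v ≤
      acc init (S[z]'hz).1 (inducedList T (S.take z))

/-- A valid processing sequence. -/
def Valid {n : ℕ} (init : Fin n → ℤ) (T : Fin n → List (Fin n × ℤ))
    (S : List (Fin n × ℕ)) : Prop :=
  IsProcSeq T S ∧ FIFO S ∧ Balance init T S

theorem sum_map_filter_le_of_subset {α : Type*} {f : α → ℤ} {P : α → Bool} {L₁ L₂ : List α}
    (h₁ : L₁.Nodup) (hf : ∀ e ∈ L₂, 0 ≤ f e) (h : ∀ e ∈ L₁, P e = true → e ∈ L₂) :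
    ((L₁.filter P).map f).sum ≤ ((L₂.filter P).map f).sum := by
  have hsub : (L₁.filter P).Subperm (L₂.filter P) :=
    (h₁.filter P).subperm fun e he => by
      obtain ⟨he, hP⟩ := List.mem_filter.1 he
      exact List.mem_filter.2 ⟨h e he hP, hP⟩
  obtain ⟨l, hl, hs⟩ := hsub
  rw [← (hl.map f).sum_eq]
  refine (hs.map f).sum_le_sum fun a ha => ?_
  obtain ⟨e, he, rfl⟩ := List.mem_map.1 ha
  exact hf e (List.mem_filter.1 he).1

theorem inducedTransfer_v_nonneg {n : ℕ} {T : Fin n → List (Fin n × ℤ)}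
    (hT : ∀ p : Fin n, ∀ x ∈ T p, 0 ≤ x.2) (e : Fin n × ℕ) : 0 ≤ (inducedTransfer T e).v := by
  by_cases h : e.2 < (T e.1).length
  · simpa [inducedTransfer, h] using hT e.1 _ (List.getElem_mem h)
  · simp [inducedTransfer, not_lt.1 h]

theorem plus_inducedList {n : ℕ} (T : Fin n → List (Fin n × ℤ)) (j : Fin n)
    (L : List (Fin n × ℕ)) :
    plus j (inducedList T L) =
      ((L.filter fun e => decide ((inducedTransfer T e).r = j)).map
        fun e => (inducedTransfer T e).v).sum := by
  simp [plus, inducedList, List.filter_map, Function.comp_def]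

theorem minus_inducedList {n : ℕ} (T : Fin n → List (Fin n × ℤ)) (j : Fin n)
    (L : List (Fin n × ℕ)) :
    minus j (inducedList T L) =
      ((L.filter fun e => decide (e.1 = j)).map fun e => (inducedTransfer T e).v).sum := by
  simp [minus, inducedList, List.filter_map, Function.comp_def, inducedTransfer]

/-- An account does not decrease when more events are processed, as long as none of the
additional events is issued by its owner. -/
theorem acc_inducedList_le {n : ℕ} (init : Fin n → ℤ) {T : Fin n → List (Fin n × ℤ)}
    (hT : ∀ p : Fin n, ∀ x ∈ T p, 0 ≤ x.2) {p : Fin n} {L₁ L₂ : List (Fin n × ℕ)}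
    (h₁ : L₁.Nodup) (h₂ : L₂.Nodup) (h : ∀ e ∈ L₁, e ∈ L₂)
    (hp : ∀ e ∈ L₂, e.1 = p → e ∈ L₁) :
    acc init p (inducedList T L₁) ≤ acc init p (inducedList T L₂) := by
  have hplus : plus p (inducedList T L₁) ≤ plus p (inducedList T L₂) := by
    rw [plus_inducedList, plus_inducedList]
    exact sum_map_filter_le_of_subset h₁ (fun e _ => inducedTransfer_v_nonneg hT e)
      fun e he _ => h e he
  have hminus : minus p (inducedList T L₂) ≤ minus p (inducedList T L₁) := by
    rw [minus_inducedList, minus_inducedList]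
    exact sum_map_filter_le_of_subset h₂ (fun e _ => inducedTransfer_v_nonneg hT e)
      fun e he hep => hp e he (of_decide_eq_true hep)
  unfold acc
  linarith

theorem FIFO.mem_of_lt {n : ℕ} {S : List (Fin n × ℕ)} (hS : FIFO S) {p : Fin n} {m m' : ℕ}
    (hm : (p, m) ∈ S) (h : m' < m) : (p, m') ∈ S := by
  obtain ⟨z, hz, hze⟩ := List.getElem_of_mem hm
  obtain ⟨z', hz', -, hz'e⟩ := hS z hz m' (by rw [hze]; exact h)
  rw [hze] at hz'e
  exact hz'e ▸ List.getElem_mem hz'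

theorem Valid.append_singleton {n : ℕ} {init : Fin n → ℤ} {T : Fin n → List (Fin n × ℤ)}
    {S : List (Fin n × ℕ)} (hS : Valid init T S) {e : Fin n × ℕ} (he : e ∉ S)
    (hlen : e.2 < (T e.1).length) (hfifo : ∀ m' < e.2, (e.1, m') ∈ S)
    (hbal : (inducedTransfer T e).v ≤ acc init e.1 (inducedList T S)) :
    Valid init T (S ++ [e]) := by
  obtain ⟨⟨hnd, hev⟩, hF, hB⟩ := hS
  refine ⟨⟨?_, ?_⟩, ?_, ?_⟩
  · exact hnd.append (List.nodup_singleton e) (by simpa using he)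
  · intro a ha
    rcases List.mem_append.1 ha with ha | ha
    · exact hev a ha
    · rwa [List.mem_singleton.1 ha]
  · intro z hz m' hm'
    by_cases hzS : z < S.length
    · rw [List.getElem_append_left hzS] at hm' ⊢
      obtain ⟨z', hz', hlt, heq⟩ := hF z hzS m' hm'
      exact ⟨z', by simp; omega, hlt, by rw [List.getElem_append_left hz', heq]⟩
    · obtain rfl : z = S.length := by simp at hz; omega
      rw [List.getElem_concat_length rfl] at hm' ⊢
      obtain ⟨z', hz', heq⟩ := List.getElem_of_mem (hfifo m' hm')
      exact ⟨z', by simp; omega, hz', by rw [List.getElem_append_left hz', heq]⟩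
  · intro z hz
    by_cases hzS : z < S.length
    · rw [List.getElem_append_left hzS, List.take_append_of_le_length hzS.le]
      exact hB z hzS
    · obtain rfl : z = S.length := by simp at hz; omega
      rw [List.getElem_concat_length rfl, List.take_left]
      exact hbal

/-- any valid processing sequence `S'` can be extended to a
valid processing sequence containing every event of any other valid
processing sequence `S`. -/
theorem valid_extension (n : ℕ) (init : Fin n → ℤ)
    (T : Fin n → List (Fin n × ℤ))
    (hinit : ∀ j, 0 ≤ init j) (hT : ∀ p : Fin n, ∀ x ∈ T p, 0 ≤ x.2)
    (S S' : List (Fin n × ℕ))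
    (hS : Valid init T S) (hS' : Valid init T S') :
    ∃ S'' : List (Fin n × ℕ),
      Valid init T S'' ∧ S' <+: S'' ∧ ∀ e ∈ S, e ∈ S'' := by
  suffices H : ∀ k ≤ S.length, ∃ S'' : List (Fin n × ℕ),
      Valid init T S'' ∧ S' <+: S'' ∧ ∀ e ∈ S.take k, e ∈ S'' by
    simpa using H S.length le_rfl
  intro k
  induction k with
  | zero => exact fun _ => ⟨S', hS', List.prefix_rfl, by simp⟩
  | succ k ih =>
    intro hk
    obtain ⟨R, hR, hpre, hmem⟩ := ih (by omega)
    have hkS : k < S.length := hk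
    obtain ⟨⟨hnd, hev⟩, hF, hB⟩ := hS
    rw [List.take_add_one, List.getElem?_eq_getElem hkS]
    have hearlier : ∀ m' < S[k].2, (S[k].1, m') ∈ S.take k := by
      intro m' hm'
      obtain ⟨z', hz', hlt, heq⟩ := hF k hkS m' hm'
      rw [← heq]
      exact List.mem_take_iff_getElem.2 ⟨z', by omega, rfl⟩
    by_cases he : S[k] ∈ R
    · refine ⟨R, hR, hpre, fun a ha => ?_⟩
      rcases List.mem_append.1 ha with ha | ha
      · exact hmem a ha
      · rwa [show a = S[k] by simpa using ha]
    · refine ⟨R ++ [S[k]], ?_, hpre.trans (List.prefix_append _ _), fun a ha => ?_⟩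
      · refine hR.append_singleton he (hev _ (List.getElem_mem hkS))
          (fun m' hm' => hmem _ (hearlier m' hm')) ((hB k hkS).trans ?_)
        refine acc_inducedList_le init hT (hnd.sublist (List.take_sublist _ _)) hR.1.1 hmem ?_
        rintro ⟨q, m⟩ hqm rfl
        rcases lt_trichotomy m S[k].2 with h | h | h
        · exact hearlier m h
        · subst h
          exact absurd hqm he
        · exact absurd (hR.2.1.mem_of_lt hqm h) he
      · rcases List.mem_append.1 ha with ha | ha
        · exact List.mem_append_left _ (hmem a ha)
        · exact List.mem_append_right _ (by simpa using ha)
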